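/- Let u, v : ℝ × ℝ → ℝ be smooth functions of (x,t) solving the generalized Riemann equation at N=2, i.e. u_t = 2u·u_x − 2v and v_t = 2u·v_x. Then at every point (x,t): ∂_t(u + 2t·v + 2t²·u_x·v) = ∂_x(t²·(4u·u_x·v − 2v²) + 4t·u·v + u²). -/

import Mathlib

/-- Partial derivative with respect to the first variable `x`. -/
noncomputable def pdx (f : ℝ × ℝ → ℝ) (p : ℝ × ℝ) : ℝ := deriv (fun x => f (x, p.2)) p.1

/-- Partial derivative with respect to the second variable `t`. -/
noncomputable def pdt (f : ℝ × ℝ → ℝ) (p : ℝ × ℝ) : ℝ := deriv (fun t => f (p.1, t)) p.2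

theorem hasDerivAt_pdx {f : ℝ × ℝ → ℝ} (hf : Differentiable ℝ f) (p : ℝ × ℝ) :
    HasDerivAt (fun x => f (x, p.2)) (pdx f p) p.1 := by
  have hg : Differentiable ℝ fun x : ℝ => f (x, p.2) := by fun_prop
  exact (hg p.1).hasDerivAt

theorem hasDerivAt_pdt {f : ℝ × ℝ → ℝ} (hf : Differentiable ℝ f) (p : ℝ × ℝ) :
    HasDerivAt (fun t => f (p.1, t)) (pdt f p) p.2 := by
  have hg : Differentiable ℝ fun t : ℝ => f (p.1, t) := by fun_prop
  exact (hg p.2).hasDerivAt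

theorem pdx_eq_fderiv {f : ℝ × ℝ → ℝ} (hf : Differentiable ℝ f) :
    pdx f = fun p => fderiv ℝ f p (1, 0) := by
  funext p
  exact ((hf p).hasFDerivAt.comp_hasDerivAt p.1
    ((hasDerivAt_id p.1).prodMk (hasDerivAt_const p.1 p.2))).deriv

theorem pdt_eq_fderiv {f : ℝ × ℝ → ℝ} (hf : Differentiable ℝ f) :
    pdt f = fun p => fderiv ℝ f p (0, 1) := by
  funext p
  exact ((hf p).hasFDerivAt.comp_hasDerivAt p.2
    ((hasDerivAt_const p.2 p.1).prodMk (hasDerivAt_id p.2))).deriv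

theorem differentiable_pdx {f : ℝ × ℝ → ℝ} (hf : ContDiff ℝ 2 f) :
    Differentiable ℝ (pdx f) := by
  rw [pdx_eq_fderiv (hf.differentiable (by norm_num))]
  have h := (hf.fderiv_right (m := 1) (by norm_num)).differentiable (by norm_num)
  fun_prop

/-- Mixed partial derivatives of a `C²` function commute. -/
theorem pdt_pdx_eq_pdx_pdt {f : ℝ × ℝ → ℝ} (hf : ContDiff ℝ 2 f) :
    pdt (pdx f) = pdx (pdt f) := by
  have hd : Differentiable ℝ f := hf.differentiable (by norm_num)
  have h : Differentiable ℝ (fderiv ℝ f) :=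
    (hf.fderiv_right (m := 1) (by norm_num)).differentiable (by norm_num)
  have key : ∀ (w : ℝ × ℝ) (p : ℝ × ℝ),
      fderiv ℝ (fun q => fderiv ℝ f q w) p = (fderiv ℝ (fderiv ℝ f) p).flip w := by
    intro w p
    rw [fderiv_clm_apply (h p) (by fun_prop)]
    simp
  rw [pdx_eq_fderiv hd, pdt_eq_fderiv hd, pdt_eq_fderiv (by fun_prop),
    pdx_eq_fderiv (by fun_prop)]
  funext p
  simp only [key, ContinuousLinearMap.flip_apply]
  exact (hf.contDiffAt.isSymmSndFDerivAt (by simp)) _ _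

theorem riemannN2_time_dependent_conservation_law_2 (u v : ℝ × ℝ → ℝ)
    (hu : ContDiff ℝ (⊤ : ℕ∞) u) (hv : ContDiff ℝ (⊤ : ℕ∞) v)
    (hequ : ∀ p : ℝ × ℝ, pdt u p = 2 * u p * pdx u p - 2 * v p)
    (heqv : ∀ p : ℝ × ℝ, pdt v p = 2 * u p * pdx v p) :
    ∀ p : ℝ × ℝ,
      pdt (fun q => u q + 2 * q.2 * v q + 2 * q.2 ^ 2 * pdx u q * v q) p
        = pdx (fun q => q.2 ^ 2 * (4 * u q * pdx u q * v q - 2 * (v q) ^ 2)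
            + 4 * q.2 * u q * v q + (u q) ^ 2) p := by
  intro p
  have hu2 : ContDiff ℝ 2 u := contDiff_infty.1 hu 2
  have hdu : Differentiable ℝ u := hu2.differentiable (by norm_num)
  have hdv : Differentiable ℝ v := hv.differentiable (by simp)
  have hdux := differentiable_pdx hu2
  have hux := hasDerivAt_pdx hdu p
  have hvx := hasDerivAt_pdx hdv p
  have huxx := hasDerivAt_pdx hdux p
  have hut := hasDerivAt_pdt hdu p
  have hvt := hasDerivAt_pdt hdv p
  have huxt := hasDerivAt_pdt hdux p
  have hid := hasDerivAt_id' p.2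
  have hmixed : pdt (pdx u) p
      = 2 * (pdx u p * pdx u p + u p * pdx (pdx u) p) - 2 * pdx v p := by
    rw [pdt_pdx_eq_pdx_pdt hu2, funext hequ]
    refine (((hux.const_mul 2).mul huxx).sub (hvx.const_mul 2)).deriv.trans ?_
    simp only [Prod.mk.eta]
    ring
  have hL := (hut.add ((hid.const_mul 2).mul hvt)).add
    ((((hid.pow 2).const_mul 2).mul huxt).mul hvt)
  have hR := (((((hux.const_mul 4).mul huxx).mul hvx).sub
    ((hvx.pow 2).const_mul 2)).const_mul (p.2 ^ 2)).add
    ((hux.const_mul (4 * p.2)).mul hvx) |>.add (hux.pow 2)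
  refine hL.deriv.trans (Eq.trans ?_ hR.deriv.symm)
  simp only [Pi.mul_apply, Pi.pow_apply, Prod.mk.eta, hmixed, hequ, heqv]
  push_cast
  ring
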